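/- arXiv:1610.09967 — 2 statements merged into one kernel-verified Lean document; each statement's English description precedes it below -/
import Mathlib

section
/- Let 0 < λ < 1 and let 1 < p < q be real numbers. Then the ℓ^p → ℓ^q norm of the thinning T_λ is achieved by a geometric probability distribution: there exists z ∈ (0,1) such that ‖T_λ(ω(z))‖_q < ∞ and, for every sequence x : ℕ → ℂ with ‖x‖_p < ∞, ‖T_λ(x)‖_q · ‖ω(z)‖_p ≤ ‖T_λ(ω(z))‖_q · ‖x‖_p. -/
/-- The ℓ^p norm of a sequence of complex numbers. -/
noncomputable def lpNorm (p : ℝ) (x : ℕ → ℂ) : ℝ :=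
  (∑' n : ℕ, ‖x n‖ ^ p) ^ (1 / p)

/-- The thinning with parameter `l` acting on sequences of complex numbers:
`[T_l(x)]_n = ∑_{k} C(k,n) l^n (1-l)^{k-n} x_k`. -/
noncomputable def thin (l : ℝ) (x : ℕ → ℂ) : ℕ → ℂ :=
  fun n => ∑' k : ℕ, (Nat.choose k n : ℂ) * (l : ℂ) ^ n * ((1 - l : ℝ) : ℂ) ^ (k - n) * x k

/-- The geometric probability distribution on ℕ with ratio `z`, as a complex sequence. -/
noncomputable def geom (z : ℝ) : ℕ → ℂ := fun n => (((1 - z) * z ^ n : ℝ) : ℂ)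

/-- The function maximised by the geometric ratio. -/
noncomputable def phiAux (l P Q u : ℝ) : ℝ := (1 - u ^ Q) ^ (P / Q) / (1 - (1 - l + l * u) ^ P)

theorem den_pos {l P u : ℝ} (hl : 0 < l) (hl1 : l < 1) (hP : 1 < P) (h0 : 0 ≤ u) (h1 : u < 1) :
    0 < 1 - (1 - l + l * u) ^ P := by
  have : (1 - l + l * u) ^ P < 1 := Real.rpow_lt_one (by nlinarith) (by nlinarith) (by linarith)
  linarith

theorem phi_cont {l P Q : ℝ} (hl : 0 < l) (hl1 : l < 1) (hQ : 1 < Q) (hPQ : Q < P) :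
    ContinuousOn (phiAux l P Q) (Set.Icc 0 1) := by
  have hQ0 : 0 < Q := by linarith
  have hr : 1 < P / Q := by rw [lt_div_iff₀ hQ0]; linarith
  intro u hu
  rcases eq_or_lt_of_le hu.2 with h1 | h1
  · subst h1
    have hv : phiAux l P Q 1 = 0 := by simp [phiAux]
    unfold ContinuousWithinAt
    rw [hv]
    have hlim : Filter.Tendsto (fun u : ℝ => Q ^ (P / Q) / l * (1 - u) ^ (P / Q - 1))
        (nhdsWithin 1 (Set.Icc 0 1)) (nhds 0) := by
      have hc : ContinuousAt (fun u : ℝ => Q ^ (P / Q) / l * (1 - u) ^ (P / Q - 1)) 1 := by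
        apply ContinuousAt.mul continuousAt_const
        apply ContinuousAt.rpow_const (by fun_prop)
        right; linarith
      have := hc.tendsto
      have h0 : Q ^ (P / Q) / l * (1 - (1:ℝ)) ^ (P / Q - 1) = 0 := by
        rw [sub_self, Real.zero_rpow (by linarith), mul_zero]
      rw [h0] at this
      exact this.mono_left nhdsWithin_le_nhds
    refine tendsto_of_tendsto_of_tendsto_of_le_of_le' tendsto_const_nhds hlim ?_ ?_
    · filter_upwards [self_mem_nhdsWithin] with u hu
      have hx : u ^ Q ≤ 1 := Real.rpow_le_one hu.1 hu.2 hQ0.le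
      have hy : (1 - l + l * u) ^ P ≤ 1 :=
        Real.rpow_le_one (by nlinarith [hu.1]) (by nlinarith [hu.2]) (by linarith)
      exact div_nonneg (Real.rpow_nonneg (by linarith) _) (by linarith)
    · filter_upwards [self_mem_nhdsWithin] with u hu
      rcases eq_or_lt_of_le hu.2 with h1 | h1
      · subst h1
        rw [hv, sub_self, Real.zero_rpow (by linarith), mul_zero]
      have hd := den_pos hl hl1 (hQ.trans hPQ) hu.1 h1
      have hb : 1 - u ^ Q ≤ Q * (1 - u) := by
        have := one_add_mul_self_le_rpow_one_add (s := u - 1) (by linarith [hu.1]) hQ.le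
        rw [show 1 + (u - 1) = u by ring] at this
        linarith
      have hd2 : l * (1 - u) ≤ 1 - (1 - l + l * u) ^ P := by
        have := Real.rpow_le_rpow_of_exponent_ge (x := 1 - l + l * u) (by nlinarith [hu.1])
          (by nlinarith) (hQ.trans hPQ).le
        rw [Real.rpow_one] at this
        linarith
      have hx : u ^ Q ≤ 1 := Real.rpow_le_one hu.1 hu.2 hQ0.le
      have h1u : 0 < 1 - u := by linarith
      have hn : (1 - u ^ Q) ^ (P / Q) ≤ Q ^ (P / Q) * (1 - u) ^ (P / Q) := by
        rw [← Real.mul_rpow hQ0.le h1u.le]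
        exact Real.rpow_le_rpow (by linarith) hb (by linarith)
      unfold phiAux
      calc _ ≤ (Q ^ (P / Q) * (1 - u) ^ (P / Q)) / (l * (1 - u)) := by
            apply div_le_div₀ _ hn (by positivity) hd2
            positivity
        _ = _ := by
            rw [Real.rpow_sub h1u, Real.rpow_one]
            field_simp
  · have hd := den_pos hl hl1 (hQ.trans hPQ) hu.1 h1
    apply ContinuousAt.continuousWithinAt
    unfold phiAux
    apply ContinuousAt.div
    · apply ContinuousAt.rpow_const
      · exact continuousAt_const.sub (continuousAt_id.rpow_const (Or.inr hQ0.le))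
      · right; linarith
    · apply continuousAt_const.sub
      apply ContinuousAt.rpow_const (by fun_prop)
      right; linarith
    · exact hd.ne'

theorem phi_zero_lt {l P Q : ℝ} (hl : 0 < l) (hl1 : l < 1) (hQ : 1 < Q) (hPQ : Q < P) :
    ∃ u ∈ Set.Ioo (0:ℝ) 1, phiAux l P Q 0 < phiAux l P Q u := by
  have hQ0 : 0 < Q := by linarith
  have hr : 1 < P / Q := by rw [lt_div_iff₀ hQ0]; linarith
  have hm : 0 < 1 - l := by linarith
  set m := 1 - l with hmdef
  have hmP : 0 < m ^ P := Real.rpow_pos_of_pos hm P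
  have hmP1 : m ^ P < 1 := Real.rpow_lt_one hm.le (by linarith) (by linarith)
  set c := m ^ P * (P * (l / m)) with hc
  have hcpos : 0 < c := by
    have : 0 < P := by linarith
    positivity
  have hlim : Filter.Tendsto (fun u : ℝ => P / Q * (1 - m ^ P) * u ^ (Q - 1))
      (nhdsWithin 0 (Set.Ioi 0)) (nhds 0) := by
    have hcont : ContinuousAt (fun u : ℝ => P / Q * (1 - m ^ P) * u ^ (Q - 1)) 0 := by
      apply ContinuousAt.mul continuousAt_const
      exact continuousAt_id.rpow_const (Or.inr (by linarith))
    have := hcont.tendsto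
    have h0 : P / Q * (1 - m ^ P) * (0:ℝ) ^ (Q - 1) = 0 := by
      rw [Real.zero_rpow (by linarith), mul_zero]
    rw [h0] at this
    exact this.mono_left nhdsWithin_le_nhds
  have hev := (hlim.eventually_lt_const hcpos).and
    (Ioo_mem_nhdsGT (show (0:ℝ) < 1 by norm_num))
  obtain ⟨u, hu1, hu⟩ := hev.exists
  refine ⟨u, hu, ?_⟩
  have hd := den_pos hl hl1 (hQ.trans hPQ) hu.1.le hu.2
  rw [← hmdef] at hd
  unfold phiAux
  rw [← hmdef, Real.zero_rpow hQ0.ne', mul_zero, add_zero, sub_zero, Real.one_rpow,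
    div_lt_div_iff₀ (by linarith) hd, one_mul]
  have hx : u ^ Q ≤ 1 := Real.rpow_le_one hu.1.le hu.2.le hQ0.le
  have h1 : 1 - P / Q * u ^ Q ≤ (1 - u ^ Q) ^ (P / Q) := by
    have := one_add_mul_self_le_rpow_one_add (s := - u ^ Q) (by linarith) hr.le
    rw [← sub_eq_add_neg] at this
    linarith
  have h2 : m ^ P + c * u ≤ (m + l * u) ^ P := by
    have hlu : 0 < l / m * u := mul_pos (by positivity) hu.1
    have := one_add_mul_self_le_rpow_one_add (s := l / m * u) (by linarith) (hQ.trans hPQ).le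
    have e : m + l * u = m * (1 + l / m * u) := by field_simp
    rw [e, Real.mul_rpow hm.le (by linarith), hc]
    nlinarith
  have h3 : u ^ Q = u ^ (Q - 1) * u := by
    rw [← Real.rpow_add_one hu.1.ne']; congr 1; ring
  have h4 : P / Q * (1 - m ^ P) * u ^ Q < c * u := by
    rw [h3, ← mul_assoc]; exact mul_lt_mul_of_pos_right hu1 hu.1
  nlinarith

theorem exists_u {l P Q : ℝ} (hl : 0 < l) (hl1 : l < 1) (hQ : 1 < Q) (hPQ : Q < P) :
    ∃ u ∈ Set.Ioo (0:ℝ) 1, ∀ t ∈ Set.Icc (0:ℝ) 1,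
      (1 - t ^ Q) ^ (P / Q) ≤ phiAux l P Q u * (1 - (1 - l + l * t) ^ P) := by
  obtain ⟨u, hu, hmax⟩ := isCompact_Icc.exists_isMaxOn (s := Set.Icc (0:ℝ) 1) ⟨0, by simp⟩
    (phi_cont hl hl1 hQ hPQ)
  obtain ⟨w, hw, hlt⟩ := phi_zero_lt hl hl1 hQ hPQ
  have hQ0 : 0 < Q := by linarith
  have hr : 1 < P / Q := by rw [lt_div_iff₀ hQ0]; linarith
  have hwu : phiAux l P Q w ≤ phiAux l P Q u := hmax ⟨hw.1.le, hw.2.le⟩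
  refine ⟨u, ⟨?_, ?_⟩, ?_⟩
  · rcases eq_or_lt_of_le hu.1 with h | h
    · subst h; linarith
    · exact h
  · rcases eq_or_lt_of_le hu.2 with h | h
    · subst h
      have h1 : phiAux l P Q 1 = 0 := by simp [phiAux]
      have hd := den_pos hl hl1 (hQ.trans hPQ) le_rfl zero_lt_one
      have h0 : 0 ≤ phiAux l P Q 0 := by
        unfold phiAux
        apply div_nonneg _ hd.le
        rw [Real.zero_rpow hQ0.ne']; simp
      linarith
    · exact h
  · intro t ht
    rcases eq_or_lt_of_le ht.2 with h | h
    · subst h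
      have : P / Q ≠ 0 := by linarith
      simp [Real.zero_rpow this]
    · have hd := den_pos hl hl1 (hQ.trans hPQ) ht.1 h
      rw [← div_le_iff₀ hd]
      exact hmax ht

/-- One step of the dual recursion. -/
noncomputable def Aop (l : ℝ) (y : ℕ → ℝ) : ℕ → ℝ := fun n => l * y (n + 1) + (1 - l) * y n

theorem step {l P Q D : ℝ} (hl : 0 < l) (hl1 : l < 1) (hQ : 1 < Q) (hPQ : Q < P) (hD : 0 ≤ D)
    (hmax : ∀ t ∈ Set.Icc (0:ℝ) 1, (1 - t ^ Q) ^ (P / Q) ≤ D * (1 - (1 - l + l * t) ^ P))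
    (N : ℕ) (y : ℕ → ℝ) (hy : ∀ n, 0 ≤ y n) (hyN : ∀ n, N ≤ n → y n = 0) :
    y 0 ^ P + D * ((∑ n ∈ Finset.range N, Aop l y n ^ Q) ^ (1 / Q)) ^ P ≤
      D * ((∑ n ∈ Finset.range N, y n ^ Q) ^ (1 / Q)) ^ P := by
  have hQ0 : 0 < Q := by linarith
  have hP0 : 0 < P := by linarith
  set M := (∑ n ∈ Finset.range N, y n ^ Q) ^ (1 / Q) with hM
  set R := (∑ n ∈ Finset.range N, y (n + 1) ^ Q) ^ (1 / Q) with hR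
  set B := (∑ n ∈ Finset.range N, Aop l y n ^ Q) ^ (1 / Q) with hB
  have hs0 : 0 ≤ ∑ n ∈ Finset.range N, y n ^ Q :=
    Finset.sum_nonneg fun n _ => Real.rpow_nonneg (hy n) _
  have hs1 : 0 ≤ ∑ n ∈ Finset.range N, y (n + 1) ^ Q :=
    Finset.sum_nonneg fun n _ => Real.rpow_nonneg (hy _) _
  have hA0 : ∀ n, 0 ≤ Aop l y n := fun n =>
    add_nonneg (mul_nonneg hl.le (hy _)) (mul_nonneg (by linarith) (hy _))
  have hs2 : 0 ≤ ∑ n ∈ Finset.range N, Aop l y n ^ Q :=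
    Finset.sum_nonneg fun n _ => Real.rpow_nonneg (hA0 n) _
  have hM0 : 0 ≤ M := Real.rpow_nonneg hs0 _
  have hR0 : 0 ≤ R := Real.rpow_nonneg hs1 _
  have hB0 : 0 ≤ B := Real.rpow_nonneg hs2 _
  have hMQ : M ^ Q = ∑ n ∈ Finset.range N, y n ^ Q := by
    rw [hM, ← Real.rpow_mul hs0, one_div_mul_cancel hQ0.ne', Real.rpow_one]
  have hRQ : R ^ Q = ∑ n ∈ Finset.range N, y (n + 1) ^ Q := by
    rw [hR, ← Real.rpow_mul hs1, one_div_mul_cancel hQ0.ne', Real.rpow_one]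
  have hsum : M ^ Q = R ^ Q + y 0 ^ Q := by
    rw [hMQ, hRQ]
    have h := Finset.sum_range_succ' (fun n => y n ^ Q) N
    rw [Finset.sum_range_succ, hyN N le_rfl, Real.zero_rpow hQ0.ne', add_zero] at h
    exact h
  have hBle : B ≤ l * R + (1 - l) * M := by
    have h := Real.Lp_add_le_of_nonneg (Finset.range N) (f := fun n => l * y (n + 1))
      (g := fun n => (1 - l) * y n) hQ.le (fun n _ => mul_nonneg hl.le (hy _))
      (fun n _ => mul_nonneg (by linarith) (hy _))
    have e : ∀ (c : ℝ) (f : ℕ → ℝ), 0 ≤ c → (∀ n, 0 ≤ f n) →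
        (∑ n ∈ Finset.range N, (c * f n) ^ Q) ^ (1 / Q) =
          c * (∑ n ∈ Finset.range N, f n ^ Q) ^ (1 / Q) := by
      intro c f hc hf
      have : ∀ n ∈ Finset.range N, (c * f n) ^ Q = c ^ Q * f n ^ Q :=
        fun n _ => Real.mul_rpow hc (hf n)
      rw [Finset.sum_congr rfl this, ← Finset.mul_sum, Real.mul_rpow (Real.rpow_nonneg hc _)
        (Finset.sum_nonneg fun n _ => Real.rpow_nonneg (hf n) _), ← Real.rpow_mul hc,
        mul_one_div_cancel hQ0.ne', Real.rpow_one]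
    rw [e l (fun n => y (n + 1)) hl.le (fun n => hy _), e (1 - l) y (by linarith) hy] at h
    exact h
  have hy0Q : 0 ≤ y 0 ^ Q := Real.rpow_nonneg (hy 0) _
  have hRM : R ≤ M := by
    rw [← Real.rpow_le_rpow_iff hR0 hM0 hQ0]; linarith
  rcases eq_or_lt_of_le hM0 with h0 | hMpos
  · have hR' : R = 0 := le_antisymm (by linarith) hR0
    have hB' : B = 0 := le_antisymm (by rw [hR', ← h0] at hBle; simpa using hBle) hB0
    have hy0 : y 0 = 0 := by
      rw [hR', ← h0, Real.zero_rpow hQ0.ne', zero_add] at hsum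
      exact ((Real.rpow_eq_zero (hy 0) hQ0.ne').1 hsum.symm)
    rw [hB', ← h0, hy0, Real.zero_rpow hP0.ne']; simp
  · set t := R / M with ht
    have ht0 : 0 ≤ t := by positivity
    have ht1 : t ≤ 1 := by rw [ht, div_le_one hMpos]; exact hRM
    have hRt : R = t * M := by rw [ht]; field_simp
    have hm := hmax t ⟨ht0, ht1⟩
    have htQ : t ^ Q ≤ 1 := Real.rpow_le_one ht0 ht1 hQ0.le
    have hyt : y 0 ^ Q = (1 - t ^ Q) * M ^ Q := by
      rw [hRt, Real.mul_rpow ht0 hM0] at hsum; linarith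
    have hyP : y 0 ^ P = (1 - t ^ Q) ^ (P / Q) * M ^ P := by
      have e : Q * (P / Q) = P := by field_simp
      have : (y 0 ^ Q) ^ (P / Q) = ((1 - t ^ Q) * M ^ Q) ^ (P / Q) := by rw [hyt]
      rw [Real.mul_rpow (by linarith) (Real.rpow_nonneg hM0 _), ← Real.rpow_mul (hy 0),
        ← Real.rpow_mul hM0, e] at this
      exact this
    have hBP : B ^ P ≤ (1 - l + l * t) ^ P * M ^ P := by
      rw [← Real.mul_rpow (by nlinarith) hM0]
      apply Real.rpow_le_rpow hB0 _ hP0.le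
      rw [hRt] at hBle; linarith
    have hMP : 0 ≤ M ^ P := Real.rpow_nonneg hM0 _
    have h1 := mul_le_mul_of_nonneg_right hm hMP
    have h2 := mul_le_mul_of_nonneg_left hBP hD
    rw [hyP]
    linarith

theorem iter {l P Q D : ℝ} (hl : 0 < l) (hl1 : l < 1) (hQ : 1 < Q) (hPQ : Q < P) (hD : 0 ≤ D)
    (hmax : ∀ t ∈ Set.Icc (0:ℝ) 1, (1 - t ^ Q) ^ (P / Q) ≤ D * (1 - (1 - l + l * t) ^ P))
    (N K : ℕ) : ∀ (y : ℕ → ℝ) (_ : ∀ n, 0 ≤ y n) (_ : ∀ n, N ≤ n → y n = 0),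
    ∑ k ∈ Finset.range K, ((Aop l)^[k] y 0) ^ P ≤
      D * ((∑ n ∈ Finset.range N, y n ^ Q) ^ (1 / Q)) ^ P := by
  induction K with
  | zero =>
    intro y hy _
    simp only [Finset.range_zero, Finset.sum_empty]
    exact mul_nonneg hD (Real.rpow_nonneg (Real.rpow_nonneg
      (Finset.sum_nonneg fun n _ => Real.rpow_nonneg (hy n) _) _) _)
  | succ K ih =>
    intro y hy hyN
    rw [Finset.sum_range_succ']
    have h := ih (Aop l y)
      (fun n => add_nonneg (mul_nonneg hl.le (hy _)) (mul_nonneg (by linarith) (hy _)))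
      (fun n hn => by simp [Aop, hyN n hn, hyN (n + 1) (by omega)])
    have hs := step hl hl1 hQ hPQ hD hmax N y hy hyN
    simp only [Function.iterate_succ, Function.comp_apply, Function.iterate_zero, id]
    linarith

theorem Aop_iterate (l : ℝ) (k : ℕ) (y : ℕ → ℝ) :
    (Aop l)^[k] y 0 = ∑ n ∈ Finset.range (k + 1), (k.choose n : ℝ) * l ^ n * (1 - l) ^ (k - n) * y n := by
  let S : Module.End ℝ (ℕ → ℝ) := LinearMap.funLeft ℝ ℝ Nat.succ
  have hS : ∀ n (y : ℕ → ℝ) j, (S ^ n) y j = y (n + j) := by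
    intro n
    induction n with
    | zero => intro y j; simp
    | succ n ih =>
      intro y j
      rw [pow_succ, Module.End.mul_apply, ih]
      simp only [S, LinearMap.funLeft_apply]
      congr 1; omega
  have hA : Aop l = ⇑(l • S + (1 - l) • (1 : Module.End ℝ (ℕ → ℝ))) := by
    ext y n
    simp [Aop, S, LinearMap.funLeft_apply]
  have hc : Commute (l • S) ((1 - l) • (1 : Module.End ℝ (ℕ → ℝ))) :=
    ((Commute.one_right S).smul_right _).smul_left _
  rw [hA, ← Module.End.coe_pow, hc.add_pow, LinearMap.sum_apply, Finset.sum_apply]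
  apply Finset.sum_congr rfl
  intro n _
  rw [smul_pow, smul_pow, one_pow]
  simp only [Module.End.mul_apply, LinearMap.smul_apply, Pi.smul_apply, Module.End.one_apply,
    smul_eq_mul, Module.End.natCast_apply, map_smul, hS, nsmul_eq_mul, add_zero, Pi.mul_apply, Pi.natCast_apply]
  ring

theorem Aop_iterate' (l : ℝ) (k N : ℕ) (y : ℕ → ℝ) (hyN : ∀ n, N ≤ n → y n = 0) :
    (Aop l)^[k] y 0 = ∑ n ∈ Finset.range N, (k.choose n : ℝ) * l ^ n * (1 - l) ^ (k - n) * y n := by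
  rw [Aop_iterate]
  trans ∑ n ∈ Finset.range (max (k + 1) N), (k.choose n : ℝ) * l ^ n * (1 - l) ^ (k - n) * y n
  · apply Finset.sum_subset (Finset.range_mono (le_max_left _ _))
    intro n _ hn
    rw [Nat.choose_eq_zero_of_lt (by simpa using hn)]; simp
  · symm
    apply Finset.sum_subset (Finset.range_mono (le_max_right _ _))
    intro n _ hn
    rw [hyN n (by simpa using hn)]; simp

/-- The real thinning kernel. -/
noncomputable def ker (l : ℝ) (n k : ℕ) : ℝ := (k.choose n : ℝ) * l ^ n * (1 - l) ^ (k - n)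

theorem ker_nonneg {l : ℝ} (hl : 0 < l) (hl1 : l < 1) (n k : ℕ) : 0 ≤ ker l n k := by
  have : 0 ≤ 1 - l := by linarith
  unfold ker; positivity

theorem ker_geom {l z : ℝ} (hl : 0 < l) (hl1 : l < 1) (hz : 0 < z) (hz1 : z ≤ 1) (n : ℕ) :
    HasSum (fun k => ker l n k * z ^ k) ((l * z) ^ n / (1 - (1 - l) * z) ^ (n + 1)) := by
  have hm : 0 < 1 - l := by linarith
  have hlt : (1 - l) * z < 1 := by nlinarith
  have hn : ‖(1 - l) * z‖ < 1 := by
    rw [Real.norm_eq_abs, abs_of_pos (by positivity)]; exact hlt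
  have h := (hasSum_choose_mul_geometric_of_norm_lt_one n hn).mul_left ((l * z) ^ n)
  have h2 : HasSum (fun k => ker l n (k + n) * z ^ (k + n))
      ((l * z) ^ n / (1 - (1 - l) * z) ^ (n + 1)) := by
    rw [mul_one_div] at h
    refine (congrArg (fun f => HasSum f _) (funext fun k => ?_)).mpr h
    unfold ker
    rw [Nat.add_sub_cancel, mul_pow (1 - l) z k]
    ring
  have h3 := (hasSum_nat_add_iff (f := fun k => ker l n k * z ^ k) n).1 h2
  rw [Finset.sum_eq_zero, add_zero] at h3
  · exact h3
  · intro k hk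
    simp [ker, Nat.choose_eq_zero_of_lt (Finset.mem_range.1 hk)]

theorem ker_summable {l : ℝ} (hl : 0 < l) (hl1 : l < 1) (n : ℕ) : Summable (fun k => ker l n k) := by
  simpa using (ker_geom hl hl1 zero_lt_one le_rfl n).summable

theorem le_lp {p : ℝ} (hp : 1 < p) {a : ℕ → ℝ} (ha : ∀ k, 0 ≤ a k)
    (hs : Summable (fun k => a k ^ p)) (k : ℕ) : a k ≤ (∑' k, a k ^ p) ^ (1 / p) := by
  have hp0 : 0 < p := by linarith
  have h := hs.le_tsum k (fun j _ => Real.rpow_nonneg (ha j) _)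
  have := Real.rpow_le_rpow (Real.rpow_nonneg (ha k) _) h (z := 1 / p) (by positivity)
  rwa [← Real.rpow_mul (ha k), mul_one_div_cancel hp0.ne', Real.rpow_one] at this

theorem ker_mul_summable {l p : ℝ} (hl : 0 < l) (hl1 : l < 1) (hp : 1 < p) {a : ℕ → ℝ}
    (ha : ∀ k, 0 ≤ a k) (hs : Summable (fun k => a k ^ p)) (n : ℕ) :
    Summable (fun k => ker l n k * a k) :=
  Summable.of_nonneg_of_le (fun k => mul_nonneg (ker_nonneg hl hl1 n k) (ha k))
    (fun k => mul_le_mul_of_nonneg_left (le_lp hp ha hs k) (ker_nonneg hl hl1 n k))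
    ((ker_summable hl hl1 n).mul_right _)

theorem upper {l p q P Q D : ℝ} (hl : 0 < l) (hl1 : l < 1) (hp : 1 < p)
    (hpP : p.HolderConjugate P) (hqQ : q.HolderConjugate Q) (hQ : 1 < Q) (hPQ : Q < P)
    (hD : 0 ≤ D)
    (hmax : ∀ t ∈ Set.Icc (0:ℝ) 1, (1 - t ^ Q) ^ (P / Q) ≤ D * (1 - (1 - l + l * t) ^ P))
    {a : ℕ → ℝ} (ha : ∀ k, 0 ≤ a k) (hs : Summable (fun k => a k ^ p)) (N : ℕ) :
    ∑ n ∈ Finset.range N, (∑' k, ker l n k * a k) ^ q ≤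
      (D ^ (1 / P) * (∑' k, a k ^ p) ^ (1 / p)) ^ q := by
  have hQ0 : 0 < Q := by linarith
  have hP0 : 0 < P := by linarith
  have hq0 : 0 < q := hqQ.pos
  set b : ℕ → ℝ := fun n => ∑' k, ker l n k * a k with hb
  set α := (∑' k, a k ^ p) ^ (1 / p) with hα
  have hα0 : 0 ≤ α := (ha 0).trans (le_lp hp ha hs 0)
  have hb0 : ∀ n, 0 ≤ b n := fun n =>
    tsum_nonneg fun k => mul_nonneg (ker_nonneg hl hl1 n k) (ha k)
  set s := ∑ n ∈ Finset.range N, b n ^ q with hsdef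
  have hs0 : 0 ≤ s := Finset.sum_nonneg fun n _ => Real.rpow_nonneg (hb0 n) _
  let y : ℕ → ℝ := fun n => if n < N then b n ^ (q - 1) else 0
  have hy : ∀ n, 0 ≤ y n := by
    intro n; simp only [y]; split_ifs
    · exact Real.rpow_nonneg (hb0 n) _
    · exact le_rfl
  have hyN : ∀ n, N ≤ n → y n = 0 := by
    intro n hn; simp only [y]; rw [if_neg (by omega)]
  have hyQ : ∑ n ∈ Finset.range N, y n ^ Q = s := by
    apply Finset.sum_congr rfl
    intro n hn
    simp only [y]
    rw [if_pos (Finset.mem_range.1 hn), ← Real.rpow_mul (hb0 n), hqQ.sub_one_mul_conj]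
  have hyb : ∑ n ∈ Finset.range N, y n * b n = s := by
    apply Finset.sum_congr rfl
    intro n hn
    simp only [y]
    rw [if_pos (Finset.mem_range.1 hn)]
    rcases eq_or_lt_of_le (hb0 n) with h | h
    · rw [← h, mul_zero, Real.zero_rpow hq0.ne']
    · rw [← Real.rpow_add_one h.ne']; congr 1; ring
  let T : ℕ → ℝ := fun k => (Aop l)^[k] y 0
  have hT : ∀ k, T k = ∑ n ∈ Finset.range N, ker l n k * y n := fun k =>
    Aop_iterate' l k N y hyN
  have hT0 : ∀ k, 0 ≤ T k := fun k => by
    rw [hT]; exact Finset.sum_nonneg fun n _ => mul_nonneg (ker_nonneg hl hl1 n k) (hy n)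
  have hit : ∀ K, ∑ k ∈ Finset.range K, T k ^ P ≤ D * (s ^ (1 / Q)) ^ P := fun K => by
    have := iter hl hl1 hQ hPQ hD hmax N K y hy hyN
    rwa [hyQ] at this
  have hTs : Summable (fun k => T k ^ P) :=
    summable_of_sum_range_le (fun k => Real.rpow_nonneg (hT0 k) _) hit
  have hTt : ∑' k, T k ^ P ≤ D * (s ^ (1 / Q)) ^ P :=
    Real.tsum_le_of_sum_range_le (fun k => Real.rpow_nonneg (hT0 k) _) hit
  have hH := Real.inner_le_Lp_mul_Lq_tsum_of_nonneg hpP.symm hT0 ha hTs hs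
  have hswap : ∑' k, T k * a k = s := by
    rw [← hyb]
    have : ∀ k, T k * a k = ∑ n ∈ Finset.range N, y n * (ker l n k * a k) := by
      intro k
      rw [hT, Finset.sum_mul]
      exact Finset.sum_congr rfl fun n _ => by ring
    rw [tsum_congr this, Summable.tsum_finsetSum
      (fun n _ => (ker_mul_summable hl hl1 hp ha hs n).mul_left _)]
    exact Finset.sum_congr rfl fun n _ => tsum_mul_left
  rw [hswap] at hH
  have hs1 : 0 ≤ s ^ (1 / Q) := Real.rpow_nonneg hs0 _
  have h1 : (∑' k, T k ^ P) ^ (1 / P) ≤ D ^ (1 / P) * s ^ (1 / Q) := by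
    have := Real.rpow_le_rpow (tsum_nonneg fun k => Real.rpow_nonneg (hT0 k) _) hTt
      (z := 1 / P) (by positivity)
    rwa [Real.mul_rpow hD (Real.rpow_nonneg hs1 _), ← Real.rpow_mul hs1,
      mul_one_div_cancel hP0.ne', Real.rpow_one] at this
  have h2 : s ≤ D ^ (1 / P) * s ^ (1 / Q) * α := hH.trans (mul_le_mul_of_nonneg_right h1 hα0)
  have hDP : 0 ≤ D ^ (1 / P) := Real.rpow_nonneg hD _
  rcases eq_or_lt_of_le hs0 with h | h
  · rw [← h]; exact Real.rpow_nonneg (mul_nonneg hDP hα0) _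
  · have hsp : 0 < s ^ (1 / Q) := Real.rpow_pos_of_pos h _
    have h3 : s = s ^ (1 / q) * s ^ (1 / Q) := by
      rw [← Real.rpow_add h, one_div, one_div, hqQ.inv_add_inv_eq_one, Real.rpow_one]
    have h4 : s ^ (1 / q) ≤ D ^ (1 / P) * α := by
      apply le_of_mul_le_mul_right _ hsp
      rw [← h3]; linarith
    have := Real.rpow_le_rpow (Real.rpow_nonneg hs0 _) h4 hq0.le
    rwa [← Real.rpow_mul hs0, one_div_mul_cancel hq0.ne', Real.rpow_one] at this

theorem thin_norm_le {l p : ℝ} (hl : 0 < l) (hl1 : l < 1) (hp : 1 < p) {x : ℕ → ℂ}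
    (hs : Summable (fun k => ‖x k‖ ^ p)) (n : ℕ) :
    ‖thin l x n‖ ≤ ∑' k, ker l n k * ‖x k‖ := by
  have e : ∀ k, ‖(Nat.choose k n : ℂ) * (l : ℂ) ^ n * ((1 - l : ℝ) : ℂ) ^ (k - n) * x k‖ =
      ker l n k * ‖x k‖ := by
    intro k
    have : (Nat.choose k n : ℂ) * (l : ℂ) ^ n * ((1 - l : ℝ) : ℂ) ^ (k - n) = (ker l n k : ℂ) := by
      unfold ker; push_cast; rfl
    rw [this, norm_mul, Complex.norm_real, Real.norm_eq_abs, abs_of_nonneg (ker_nonneg hl hl1 n k)]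
  have hsum := ker_mul_summable hl hl1 hp (fun k => norm_nonneg (x k)) hs n
  rw [← tsum_congr e]
  apply norm_tsum_le_tsum_norm
  exact hsum.congr fun k => (e k).symm

theorem thin_upper {l p q P Q D : ℝ} (hl : 0 < l) (hl1 : l < 1) (hp : 1 < p)
    (hpP : p.HolderConjugate P) (hqQ : q.HolderConjugate Q) (hQ : 1 < Q) (hPQ : Q < P)
    (hD : 0 ≤ D)
    (hmax : ∀ t ∈ Set.Icc (0:ℝ) 1, (1 - t ^ Q) ^ (P / Q) ≤ D * (1 - (1 - l + l * t) ^ P))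
    {x : ℕ → ℂ} (hs : Summable (fun k => ‖x k‖ ^ p)) :
    Summable (fun n => ‖thin l x n‖ ^ q) ∧ lpNorm q (thin l x) ≤ D ^ (1 / P) * lpNorm p x := by
  have hq0 : 0 < q := hqQ.pos
  have hb : ∀ N, ∑ n ∈ Finset.range N, ‖thin l x n‖ ^ q ≤ (D ^ (1 / P) * lpNorm p x) ^ q := by
    intro N
    refine le_trans (Finset.sum_le_sum fun n _ => Real.rpow_le_rpow (norm_nonneg _)
      (thin_norm_le hl hl1 hp hs n) hq0.le) ?_
    exact upper hl hl1 hp hpP hqQ hQ hPQ hD hmax (fun k => norm_nonneg (x k)) hs N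
  have h0 : ∀ n, 0 ≤ ‖thin l x n‖ ^ q := fun n => Real.rpow_nonneg (norm_nonneg _) _
  refine ⟨summable_of_sum_range_le h0 hb, ?_⟩
  have hc : 0 ≤ D ^ (1 / P) * lpNorm p x := mul_nonneg (Real.rpow_nonneg hD _)
    (Real.rpow_nonneg (tsum_nonneg fun n => Real.rpow_nonneg (norm_nonneg _) _) _)
  have := Real.rpow_le_rpow (tsum_nonneg h0) (Real.tsum_le_of_sum_range_le h0 hb)
    (z := 1 / q) (by positivity)
  rwa [← Real.rpow_mul hc, mul_one_div_cancel hq0.ne', Real.rpow_one] at this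

theorem thin_geom {l z : ℝ} (hl : 0 < l) (hl1 : l < 1) (hz : 0 < z) (hz1 : z < 1) (n : ℕ) :
    ‖thin l (geom z) n‖ = (1 - z) / (1 - (1 - l) * z) * (l * z / (1 - (1 - l) * z)) ^ n := by
  have hd : 0 < 1 - (1 - l) * z := by nlinarith
  have h := (ker_geom hl hl1 hz hz1.le n).mul_left (1 - z)
  have hc := (Complex.hasSum_ofReal.2 h)
  have : thin l (geom z) n =
      (((1 - z) * ((l * z) ^ n / (1 - (1 - l) * z) ^ (n + 1)) : ℝ) : ℂ) := by
    rw [← hc.tsum_eq]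
    unfold thin geom ker
    apply tsum_congr
    intro k
    push_cast
    ring
  have hz' : 0 < 1 - z := by linarith
  rw [this, Complex.norm_real, Real.norm_eq_abs, abs_of_pos (by positivity)]
  rw [div_pow, pow_succ']; field_simp

theorem tsum_geom_rpow {z p : ℝ} (hz : 0 < z) (hz1 : z < 1) (hp : 0 < p) :
    HasSum (fun n : ℕ => (z ^ n) ^ p) (1 - z ^ p)⁻¹ := by
  have h1 : z ^ p < 1 := Real.rpow_lt_one hz.le hz1 hp
  have h := hasSum_geometric_of_lt_one (Real.rpow_nonneg hz.le p) h1
  refine (congrArg (fun f => HasSum f _) (funext fun n => ?_)).mpr h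
  rw [← Real.rpow_natCast, ← Real.rpow_mul hz.le, mul_comm, Real.rpow_mul hz.le, Real.rpow_natCast]

theorem geom_norm {z : ℝ} (hz : 0 < z) (hz1 : z < 1) (n : ℕ) : ‖geom z n‖ = (1 - z) * z ^ n := by
  have : 0 < 1 - z := by linarith
  unfold geom
  rw [Complex.norm_real, Real.norm_eq_abs, abs_of_pos (by positivity)]

theorem geom_hasSum {z p : ℝ} (hz : 0 < z) (hz1 : z < 1) (hp : 0 < p) :
    HasSum (fun n : ℕ => ‖geom z n‖ ^ p) ((1 - z) ^ p * (1 - z ^ p)⁻¹) := by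
  have h := (tsum_geom_rpow hz hz1 hp).mul_left ((1 - z) ^ p)
  refine (congrArg (fun f => HasSum f _) (funext fun n => ?_)).mpr h
  rw [geom_norm hz hz1, Real.mul_rpow (by linarith) (by positivity)]

theorem lower {l p q P Q u z : ℝ} (hl : 0 < l) (hl1 : l < 1)
    (hpP : p.HolderConjugate P) (hqQ : q.HolderConjugate Q)
    (hu : u ∈ Set.Ioo (0:ℝ) 1) (hz : z = (1 - l + l * u) ^ (P - 1))
    (hs : Summable (fun n => ‖thin l (geom z) n‖ ^ q)) :
    phiAux l P Q u ^ (1 / P) * lpNorm p (geom z) ≤ lpNorm q (thin l (geom z)) := by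
  obtain ⟨hu0, hu1⟩ := hu
  set v := 1 - l + l * u with hv
  have hv0 : 0 < v := by nlinarith
  have hv1 : v < 1 := by nlinarith
  have hP1 : 1 < P := hpP.symm.lt
  have hp0 : 0 < p := hpP.pos
  have hP0 : 0 < P := hpP.symm.pos
  have hQ0 : 0 < Q := hqQ.symm.pos
  have hz0 : 0 < z := hz ▸ Real.rpow_pos_of_pos hv0 _
  have hz1 : z < 1 := hz ▸ Real.rpow_lt_one hv0.le hv1 (by linarith)
  have hz1' : 0 < 1 - z := by linarith
  have hd : 0 < 1 - (1 - l) * z := by nlinarith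
  have hvz : v * z = v ^ P := by
    rw [hz, mul_comm, ← Real.rpow_add_one hv0.ne']; congr 1; ring
  have hzp : z ^ p = v ^ P := by
    rw [hz, ← Real.rpow_mul hv0.le, hpP.symm.sub_one_mul_conj]
  have hvP : v ^ P < 1 := Real.rpow_lt_one hv0.le hv1 hP0
  have huQ : u ^ Q < 1 := Real.rpow_lt_one hu0.le hu1 hQ0
  have hE : 0 < 1 - v ^ P := by linarith
  have hU : 0 < 1 - u ^ Q := by linarith
  have hgeo : lpNorm p (geom z) = (1 - z) * (1 - v ^ P) ^ (-(1 / p)) := by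
    unfold lpNorm
    rw [(geom_hasSum hz0 hz1 hp0).tsum_eq, hzp, Real.mul_rpow (by positivity) (by positivity),
      ← Real.rpow_mul hz1'.le, mul_one_div_cancel hp0.ne', Real.rpow_one, Real.inv_rpow hE.le,
      Real.rpow_neg hE.le]
  have hphi : phiAux l P Q u ^ (1 / P) = (1 - u ^ Q) ^ (1 / Q) * (1 - v ^ P) ^ (-(1 / P)) := by
    unfold phiAux
    rw [← hv, Real.div_rpow (by positivity) hE.le, ← Real.rpow_mul hU.le, Real.rpow_neg hE.le,
      div_eq_mul_inv, show P / Q * (1 / P) = 1 / Q by field_simp]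
  have hprod : phiAux l P Q u ^ (1 / P) * lpNorm p (geom z) =
      (1 - u ^ Q) ^ (1 / Q) * ((1 - z) / (1 - v ^ P)) := by
    rw [hgeo, hphi]
    have : (1 - v ^ P) ^ (-(1 / P)) * (1 - v ^ P) ^ (-(1 / p)) = (1 - v ^ P)⁻¹ := by
      rw [← Real.rpow_add hE, ← Real.rpow_neg_one]
      congr 1
      have := hpP.inv_add_inv_eq_one
      rw [one_div, one_div]; linarith
    rw [div_eq_mul_inv (1 - z), ← this]; ring
  have hgu := tsum_geom_rpow hu0 hu1 hQ0
  have hH := Real.inner_le_Lp_mul_Lq_tsum_of_nonneg hqQ.symm (f := fun n : ℕ => u ^ n)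
    (g := fun n => ‖thin l (geom z) n‖) (fun n => by positivity) (fun n => norm_nonneg _)
    hgu.summable hs
  have hsum : ∑' n : ℕ, u ^ n * ‖thin l (geom z) n‖ = (1 - z) / (1 - v ^ P) := by
    set w := l * z / (1 - (1 - l) * z) with hw
    have e : ∀ n : ℕ, u ^ n * ‖thin l (geom z) n‖ =
        (1 - z) / (1 - (1 - l) * z) * (u * w) ^ n := by
      intro n
      rw [thin_geom hl hl1 hz0 hz1, mul_pow]; ring
    have hw0 : 0 < w := by positivity
    have hw1 : w ≤ 1 := by rw [hw, div_le_one hd]; nlinarith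
    rw [tsum_congr e, tsum_mul_left, tsum_geometric_of_lt_one (by positivity) (by nlinarith),
      ← hvz]
    have e2 : (1 - (1 - l) * z) * (1 - u * w) = 1 - v * z := by
      rw [hw, hv]; field_simp; ring
    rw [← e2, ← div_div, div_eq_mul_inv _ (1 - u * w)]
  rw [hsum, hgu.tsum_eq, Real.inv_rpow hU.le] at hH
  rw [hprod]
  have hUp : 0 < (1 - u ^ Q) ^ (1 / Q) := Real.rpow_pos_of_pos hU _
  calc _ ≤ (1 - u ^ Q) ^ (1 / Q) * (((1 - u ^ Q) ^ (1 / Q))⁻¹ * lpNorm q (thin l (geom z))) :=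
        mul_le_mul_of_nonneg_left hH hUp.le
    _ = _ := by field_simp

theorem thinning_pq_norm_has_geometric_maximizer
    (l p q : ℝ) (hl : 0 < l) (hl1 : l < 1) (hp : 1 < p) (hpq : p < q) :
    ∃ z : ℝ, z ∈ Set.Ioo (0 : ℝ) 1 ∧
      Summable (fun n => ‖thin l (geom z) n‖ ^ q) ∧
      ∀ x : ℕ → ℂ, Summable (fun n => ‖x n‖ ^ p) →
        lpNorm q (thin l x) * lpNorm p (geom z) ≤ lpNorm q (thin l (geom z)) * lpNorm p x := by
  have hpP := Real.HolderConjugate.conjExponent hp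
  have hqQ := Real.HolderConjugate.conjExponent (hp.trans hpq)
  have hQ : 1 < Real.conjExponent q := hqQ.symm.lt
  have hPQ : Real.conjExponent q < Real.conjExponent p := by
    unfold Real.conjExponent
    rw [div_lt_div_iff₀ (by linarith) (by linarith)]
    nlinarith
  set P := Real.conjExponent p
  set Q := Real.conjExponent q
  obtain ⟨u, hu, hmax⟩ := exists_u hl hl1 hQ hPQ
  have hP1 : 1 < P := hQ.trans hPQ
  have hD : 0 ≤ phiAux l P Q u := by
    have huQ : u ^ Q < 1 := Real.rpow_lt_one hu.1.le hu.2 (by linarith)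
    exact div_nonneg (Real.rpow_nonneg (by linarith) _) (den_pos hl hl1 hP1 hu.1.le hu.2).le
  have hv0 : 0 < 1 - l + l * u := by nlinarith [hu.1]
  have hv1 : 1 - l + l * u < 1 := by nlinarith [hu.2]
  obtain ⟨z, hz⟩ : ∃ z, z = (1 - l + l * u) ^ (P - 1) := ⟨_, rfl⟩
  have hz0 : 0 < z := hz ▸ Real.rpow_pos_of_pos hv0 _
  have hz1 : z < 1 := hz ▸ Real.rpow_lt_one hv0.le hv1 (by linarith)
  have hs := (thin_upper hl hl1 hp hpP hqQ hQ hPQ hD hmax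
    (geom_hasSum hz0 hz1 (by linarith : 0 < p)).summable).1
  refine ⟨z, ⟨hz0, hz1⟩, hs, ?_⟩
  intro x hx
  have h1 := (thin_upper hl hl1 hp hpP hqQ hQ hPQ hD hmax hx).2
  have h2 := lower hl hl1 hpP hqQ hu hz hs
  have n1 : ∀ y : ℕ → ℂ, 0 ≤ lpNorm p y := fun y =>
    Real.rpow_nonneg (tsum_nonneg fun n => Real.rpow_nonneg (norm_nonneg _) _) _
  calc _ ≤ phiAux l P Q u ^ (1 / P) * lpNorm p x * lpNorm p (geom z) :=
        mul_le_mul_of_nonneg_right h1 (n1 _)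
    _ = phiAux l P Q u ^ (1 / P) * lpNorm p (geom z) * lpNorm p x := by ring
    _ ≤ _ := mul_le_mul_of_nonneg_right h2 (n1 _)
end

section
/- (Integrated logarithmic Sobolev inequality.) Let T > 0 and z₀ ∈ (0,1). For t ∈ [0,T] set z(t) = e^{−t} z₀ / (1 − (1 − e^{−t}) z₀), and let a : [0,T] → (0,1) be differentiable with a′(t) = μ(z(t), a(t)) for all t ∈ [0,T]. Then for every nonzero finitely supported sequence x : ℕ → ℝ with x_0 ≥ x_1 ≥ ⋯ ≥ 0, one has ‖T_{e^{−T}}(x)‖_{1/a(T)} · ‖ω(z₀)‖_{1/a(0)} ≤ ‖ω(z(T))‖_{1/a(T)} · ‖x‖_{1/a(0)}. -/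
/-- The ℓ^p norm of a real sequence. -/
noncomputable def lpNormR (p : ℝ) (x : ℕ → ℝ) : ℝ :=
  (∑' n : ℕ, |x n| ^ p) ^ (1 / p)

/-- The thinning with parameter `l` acting on real sequences:
`[T_l(x)]_n = ∑_{k} C(k,n) l^n (1-l)^{k-n} x_k`. -/
noncomputable def thinR (l : ℝ) (x : ℕ → ℝ) : ℕ → ℝ :=
  fun n => ∑' k : ℕ, (Nat.choose k n : ℝ) * l ^ n * (1 - l) ^ (k - n) * x k

/-- The geometric probability distribution on ℕ with ratio `z`. -/
noncomputable def geomR (z : ℝ) : ℕ → ℝ := fun n => (1 - z) * z ^ n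

/-- `μ(z,a) = a (a z^{(a-1)/a} - 1 + (1-a) z) / ln z`. -/
noncomputable def mu (z a : ℝ) : ℝ :=
  a * (a * z ^ ((a - 1) / a) - 1 + (1 - a) * z) / Real.log z

theorem scalar_ineq {a w m C : ℝ} (ha0 : 0 < a) (ha1 : a < 1) (hw0 : 0 < w) (hw1 : w < 1)
    (hm : m * (-Real.log w) = a * w ^ (a - 1) - 1 + (1 - a) * w ^ a)
    (hC : C * (1 - w) = w ^ a - w - m * Real.binEntropy w)
    {q : ℝ} (hq0 : 0 ≤ q) (hq1 : q ≤ 1) :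
    q ^ a - q ≤ C * (1 - q) + m * Real.binEntropy q := by
  have hlog : Real.log w < 0 := Real.log_neg hw0 hw1
  have hm0 : 0 ≤ m := by
    have h := Real.geom_mean_le_arith_mean2_weighted ha0.le (by linarith : 0 ≤ 1 - a)
      (Real.rpow_nonneg hw0.le (a - 1)) (Real.rpow_nonneg hw0.le a) (by ring)
    rw [← Real.rpow_mul hw0.le, ← Real.rpow_mul hw0.le, ← Real.rpow_add hw0] at h
    rw [show (a - 1) * a + a * (1 - a) = 0 by ring, Real.rpow_zero] at h
    by_contra hneg
    push Not at hneg
    nlinarith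
  set f : ℝ → ℝ := fun q => C * (1 - q) + m * Real.binEntropy q - (q ^ a - q) with hf
  set f' : ℝ → ℝ := fun q => -C + m * (Real.log (1 - q) - Real.log q) - (a * q ^ (a - 1) - 1) with hf'
  set f'' : ℝ → ℝ := fun q => m * (-1 / (1 - q) - 1 / q) - a * ((a - 1) * q ^ (a - 2)) with hf''
  set g : ℝ → ℝ := fun q => a * (1 - a) * (q ^ (a - 1) * (1 - q)) with hg
  have hcont : Continuous f := by
    have : Continuous (fun q : ℝ => q ^ a) := Real.continuous_rpow_const ha0.le
    fun_prop
  have hd1 : ∀ q, 0 < q → q < 1 → HasDerivAt f (f' q) q := by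
    intro q h0 h1
    have e1 := Real.hasDerivAt_binEntropy h0.ne' h1.ne
    have e2 := Real.hasDerivAt_rpow_const (p := a) (Or.inl h0.ne')
    have e3 := (((hasDerivAt_id q).const_sub 1).const_mul C).add (e1.const_mul m)
    have e4 := e3.sub (e2.sub (hasDerivAt_id q))
    refine HasDerivAt.congr_deriv (f' := _) (by simpa [hf] using! e4) ?_
    simp only [hf']
  have hd2 : ∀ q, 0 < q → q < 1 → HasDerivAt f' (f'' q) q := by
    intro q h0 h1
    have e0 : HasDerivAt (fun q : ℝ => 1 - q) (-1) q := by
      simpa using (hasDerivAt_id q).const_sub 1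
    have e1 := (e0.log (by linarith : (1:ℝ) - q ≠ 0)).sub (Real.hasDerivAt_log h0.ne')
    have e2 := Real.hasDerivAt_rpow_const (p := a - 1) (Or.inl h0.ne')
    have e4 := ((e1.const_mul m).const_add (-C)).sub ((e2.const_mul a).sub_const 1)
    refine HasDerivAt.congr_deriv (f' := _) e4 ?_
    simp only [hf'']
    rw [show a - 1 - 1 = a - 2 by ring, one_div]
  have hfg : ∀ q, 0 < q → q < 1 → f'' q = (g q - m) / (q * (1 - q)) := by
    intro q h0 h1
    have h2 : (1 - q) ≠ 0 := by linarith
    have h3 : q ^ (a - 1) = q ^ (a - 2) * q := by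
      rw [← Real.rpow_add_one h0.ne']; congr 1; ring
    simp only [hf'', hg]
    rw [h3]
    field_simp
    ring
  have hganti : ∀ r s, 0 < r → r < s → s ≤ 1 → g s < g r := by
    intro r s h0 hrs hs1
    have h1 : s ^ (a - 1) ≤ r ^ (a - 1) :=
      Real.rpow_le_rpow_of_nonpos h0 hrs.le (by linarith)
    have h2 : 0 < r ^ (a - 1) := Real.rpow_pos_of_pos h0 _
    have h3 : s ^ (a - 1) * (1 - s) < r ^ (a - 1) * (1 - r) := by
      calc s ^ (a - 1) * (1 - s) ≤ r ^ (a - 1) * (1 - s) :=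
            mul_le_mul_of_nonneg_right h1 (by linarith)
        _ < _ := mul_lt_mul_of_pos_left (by linarith) h2
    exact mul_lt_mul_of_pos_left h3 (mul_pos ha0 (by linarith))
  have hfw : f w = 0 := by simp only [hf]; linarith
  have hf1 : f 1 = 0 := by simp [hf]
  have hf'w : f' w = 0 := by
    have hwa : w ^ a = w ^ (a - 1) * w := by
      rw [← Real.rpow_add_one hw0.ne']; congr 1; ring
    have hb : Real.binEntropy w = - (w * Real.log w) - (1 - w) * Real.log (1 - w) := by
      simp [Real.binEntropy, Real.log_inv]; ring
    have : (1 - w) * f' w = 0 := by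
      simp only [hf']
      rw [hb] at hC
      rw [hwa] at hC hm
      linear_combination (-1) * hC + hm
    rcases mul_eq_zero.1 this with h | h
    · linarith
    · exact h
  have hgw : m ≤ g w := by
    by_contra hlt
    push Not at hlt
    obtain ⟨c, ⟨hc1, hc2⟩, hc⟩ := exists_hasDerivAt_eq_zero hw1 hcont.continuousOn
      (hfw.trans hf1.symm) (fun x hx => hd1 x (hw0.trans hx.1) hx.2)
    obtain ⟨d, ⟨hd1', hd2'⟩, hd⟩ := exists_hasDerivAt_eq_zero (f := f') (f' := f'') hc1
      (fun x hx => (hd2 x (hw0.trans_le hx.1) (hx.2.trans_lt hc2)).continuousAt.continuousWithinAt)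
      (hf'w.trans hc.symm) (fun x hx => hd2 x (hw0.trans hx.1) (hx.2.trans hc2))
    have hdp : 0 < d := hw0.trans hd1'
    have hdl : d < 1 := hd2'.trans hc2
    rw [hfg d hdp hdl] at hd
    have := hganti w d hw0 hd1' hdl.le
    have h5 : (g d - m) / (d * (1 - d)) < 0 :=
      div_neg_of_neg_of_pos (by linarith) (mul_pos hdp (by linarith))
    linarith
  have hgcont : ContinuousOn g (Set.Icc w 1) := by
    have : ContinuousOn (fun q : ℝ => q ^ (a - 1)) (Set.Icc w 1) := by
      apply ContinuousOn.rpow_const continuousOn_id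
      intro x hx; left; exact (hw0.trans_le hx.1).ne'
    simp only [hg]
    fun_prop
  obtain ⟨s, ⟨hs1, hs2⟩, hs⟩ : m ∈ g '' Set.Icc w 1 := by
    apply intermediate_value_Icc' hw1.le hgcont
    exact ⟨by simpa [hg] using hm0, hgw⟩
  have hs0 : 0 < s := hw0.trans_le hs1
  have hconv : ConvexOn ℝ (Set.Icc 0 s) f := by
    apply convexOn_of_hasDerivWithinAt2_nonneg (f' := f') (f'' := f'') (convex_Icc 0 s) hcont.continuousOn
    · intro x hx; rw [interior_Icc] at hx ⊢
      exact (hd1 x hx.1 (hx.2.trans_le hs2)).hasDerivWithinAt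
    · intro x hx; rw [interior_Icc] at hx ⊢
      exact (hd2 x hx.1 (hx.2.trans_le hs2)).hasDerivWithinAt
    · intro x hx; rw [interior_Icc] at hx
      have hx1 := hx.2.trans_le hs2
      rw [hfg x hx.1 hx1]
      have := hganti x s hx.1 hx.2 hs2
      exact div_nonneg (by linarith) (mul_nonneg hx.1.le (by linarith))
  have hconc : ConcaveOn ℝ (Set.Icc s 1) f := by
    apply concaveOn_of_hasDerivWithinAt2_nonpos (f' := f') (f'' := f'') (convex_Icc s 1) hcont.continuousOn
    · intro x hx; rw [interior_Icc] at hx ⊢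
      exact (hd1 x (hs0.trans hx.1) hx.2).hasDerivWithinAt
    · intro x hx; rw [interior_Icc] at hx ⊢
      exact (hd2 x (hs0.trans hx.1) hx.2).hasDerivWithinAt
    · intro x hx; rw [interior_Icc] at hx
      have hx0 := hs0.trans hx.1
      rw [hfg x hx0 hx.2]
      have := hganti s x hs0 hx.1 hx.2.le
      exact div_nonpos_of_nonpos_of_nonneg (by linarith) (mul_nonneg hx0.le (by linarith [hx.2]))
  have hleft : ∀ q, 0 ≤ q → q ≤ s → 0 ≤ f q := by
    intro q h0 h1
    rcases lt_trichotomy q w with h | h | h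
    · have := hconv.slope_le_of_hasDerivAt ⟨h0, h1⟩ ⟨hw0.le, hs1⟩ h (hd1 w hw0 hw1)
      rw [hf'w, slope_def_field, hfw] at this
      by_contra hn
      push Not at hn
      have : 0 < (0 - f q) / (w - q) := div_pos (by linarith) (by linarith)
      linarith
    · rw [h, hfw]
    · have := hconv.le_slope_of_hasDerivAt ⟨hw0.le, hs1⟩ ⟨h0, h1⟩ h (hd1 w hw0 hw1)
      rw [hf'w, slope_def_field, hfw] at this
      by_contra hn
      push Not at hn
      have : (f q - 0) / (q - w) < 0 := div_neg_of_neg_of_pos (by linarith) (by linarith)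
      linarith
  have hfin : 0 ≤ f q := by
    rcases le_total q s with h | h
    · exact hleft q hq0 h
    · have := hconc.min_le_of_mem_Icc ⟨le_rfl, hs2⟩ ⟨hs2, le_rfl⟩ ⟨h, hq1⟩
      rw [hf1] at this
      exact le_trans (le_min (hleft s hs0.le le_rfl) le_rfl) this
  simp only [hf] at hfin
  linarith

theorem holder_tail {a : ℝ} (ha0 : 0 < a) (ha1 : a < 1) (s : Finset ℕ) (f g : ℕ → ℝ)
    (hf : ∀ n, 0 ≤ f n) (hg : ∀ n, 0 ≤ g n) :
    ∑ n ∈ s, f n ^ (1 - a) * g n ^ a ≤ (∑ n ∈ s, f n) ^ (1 - a) * (∑ n ∈ s, g n) ^ a := by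
  have h1 : 0 < 1 - a := by linarith
  have hpq : Real.HolderConjugate (1 / (1 - a)) (1 / a) := by
    rw [Real.holderConjugate_iff]
    refine ⟨?_, ?_⟩
    · rw [lt_div_iff₀ h1]; linarith
    · simp
  have := Real.inner_le_Lp_mul_Lq_of_nonneg s (f := fun n => f n ^ (1 - a))
    (g := fun n => g n ^ a) hpq (fun i _ => Real.rpow_nonneg (hf i) _)
    (fun i _ => Real.rpow_nonneg (hg i) _)
  simpa [← Real.rpow_mul (hf _), ← Real.rpow_mul (hg _), h1.ne', ha0.ne'] using this

theorem static_ineq {a w m C : ℝ} (ha0 : 0 < a) (ha1 : a < 1) (hw0 : 0 < w) (hw1 : w < 1)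
    (hm : m * (-Real.log w) = a * w ^ (a - 1) - 1 + (1 - a) * w ^ a)
    (hC : C * (1 - w) = w ^ a - w - m * Real.binEntropy w) (M : ℕ) :
    ∀ (p : ℕ → ℝ), (∀ n, 0 ≤ p n) → (∀ n, M ≤ n → p n = 0) →
    ∑ n ∈ Finset.range M, ((n + 1) * (p n ^ (1 - a) * p (n + 1) ^ a) - n * p n) ≤
      C * (∑ n ∈ Finset.range M, p n) +
      m * ((∑ n ∈ Finset.range M, p n) * Real.log (∑ n ∈ Finset.range M, p n)
        - ∑ n ∈ Finset.range M, p n * Real.log (p n)) := by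
  induction M with
  | zero => intro p _ _; simp
  | succ M ih =>
    intro p hp hp0
    have ih' := ih (fun n => p (n + 1)) (fun n => hp _) (fun n hn => hp0 _ (by omega))
    set Y1 := ∑ n ∈ Finset.range M, p (n + 1) with hY1
    have hY0 : ∑ n ∈ Finset.range (M + 1), p n = Y1 + p 0 := Finset.sum_range_succ' _ _
    have hE : ∑ n ∈ Finset.range (M + 1), p n * Real.log (p n) =
        ∑ n ∈ Finset.range M, p (n + 1) * Real.log (p (n + 1)) + p 0 * Real.log (p 0) :=
      Finset.sum_range_succ' _ _
    have hH := holder_tail ha0 ha1 (Finset.range (M + 1)) p (fun n => p (n + 1)) hp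
      (fun n => hp _)
    have hY1' : ∑ n ∈ Finset.range (M + 1), p (n + 1) = Y1 := by
      rw [Finset.sum_range_succ, hp0 (M + 1) le_rfl, add_zero]
    rw [hY1', hY0] at hH
    have hA : ∑ n ∈ Finset.range (M + 1), ((n + 1) * (p n ^ (1 - a) * p (n + 1) ^ a) - n * p n)
        = ∑ n ∈ Finset.range M, ((n + 1) * (p (n + 1) ^ (1 - a) * p (n + 1 + 1) ^ a)
            - n * p (n + 1))
          + ∑ n ∈ Finset.range (M + 1), p n ^ (1 - a) * p (n + 1) ^ a - Y1 := by
      rw [Finset.sum_range_succ', Finset.sum_range_succ' (fun n => p n ^ (1 - a) * p (n + 1) ^ a),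
        hY1, ← add_assoc, ← Finset.sum_add_distrib, add_sub_right_comm, ← Finset.sum_sub_distrib]
      congr 1
      · apply Finset.sum_congr rfl
        intro n _
        push_cast
        ring
      · simp
    rw [hA, hY0, hE]
    have hY1n : 0 ≤ Y1 := Finset.sum_nonneg fun n _ => hp _
    have key : (Y1 + p 0) ^ (1 - a) * Y1 ^ a - Y1 ≤ C * p 0 +
        m * ((Y1 + p 0) * Real.log (Y1 + p 0) - Y1 * Real.log Y1 - p 0 * Real.log (p 0)) := by
      rcases (add_nonneg hY1n (hp 0)).eq_or_lt with h | h
      · have h1 : Y1 = 0 := by linarith [hp 0]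
        have h2 : p 0 = 0 := by linarith [hp 0]
        simp [h1, h2, ha0.ne']
      · set Y := Y1 + p 0 with hY
        have hs := scalar_ineq ha0 ha1 hw0 hw1 hm hC (q := Y1 / Y) (by positivity)
          (by rw [div_le_one h]; linarith [hp 0])
        have hs2 := mul_le_mul_of_nonneg_left hs h.le
        have e1 : Y * ((Y1 / Y) ^ a - Y1 / Y) = Y ^ (1 - a) * Y1 ^ a - Y1 := by
          rw [Real.div_rpow hY1n h.le, Real.rpow_sub h, Real.rpow_one]
          field_simp
        have e3 : 1 - Y1 / Y = p 0 / Y := by field_simp; linarith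
        have hml : ∀ u, 0 ≤ u → Y * ((u / Y) * Real.log (u / Y)⁻¹) = u * Real.log Y - u * Real.log u := by
          intro u hu
          rcases hu.eq_or_lt with h0 | h0
          · simp [← h0]
          · rw [Real.log_inv, Real.log_div h0.ne' h.ne']
            field_simp
            ring
        have e2 : Y * (C * (1 - Y1 / Y) + m * Real.binEntropy (Y1 / Y)) = C * p 0 +
            m * (Y * Real.log Y - Y1 * Real.log Y1 - p 0 * Real.log (p 0)) := by
          have h1 := hml Y1 hY1n
          have h2 := hml (p 0) (hp 0)
          have h3 : Y * (p 0 / Y) = p 0 := by field_simp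
          rw [Real.binEntropy, e3]
          linear_combination m * h1 + m * h2 + C * h3 - m * Real.log Y * hY
        linarith
    linarith

theorem thin_eq_sum {M : ℕ} {x : ℕ → ℝ} (hM : ∀ n, M ≤ n → x n = 0) (l : ℝ) (n : ℕ) :
    thinR l x n = ∑ k ∈ Finset.range M,
      (Nat.choose k n : ℝ) * l ^ n * (1 - l) ^ (k - n) * x k := by
  unfold thinR
  apply tsum_eq_sum
  intro k hk
  rw [hM k (by simpa using hk), mul_zero]

theorem thin_zero {M : ℕ} {x : ℕ → ℝ} (hM : ∀ n, M ≤ n → x n = 0) (l : ℝ) (n : ℕ) (hn : M ≤ n) :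
    thinR l x n = 0 := by
  rw [thin_eq_sum hM]
  apply Finset.sum_eq_zero
  intro k hk
  rw [Nat.choose_eq_zero_of_lt (by rw [Finset.mem_range] at hk; omega)]
  simp

theorem thin_pos {M : ℕ} {x : ℕ → ℝ} (hM : ∀ n, M ≤ n → x n = 0) (hp : ∀ n, n < M → 0 < x n)
    {l : ℝ} (hl0 : 0 < l) (hl1 : l ≤ 1) (n : ℕ) (hn : n < M) :
    0 < thinR l x n := by
  rw [thin_eq_sum hM]
  have h1 : 0 ≤ 1 - l := by linarith
  apply Finset.sum_pos'
  · intro k hk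
    have := hp k (by simpa using hk)
    positivity
  · refine ⟨n, by simpa using hn, ?_⟩
    have := hp n hn
    simp
    positivity

theorem thin_deriv {M : ℕ} {x : ℕ → ℝ} (hM : ∀ n, M ≤ n → x n = 0) (n : ℕ) (t : ℝ) :
    HasDerivAt (fun t => thinR (Real.exp (-t)) x n)
      ((n + 1) * thinR (Real.exp (-t)) x (n + 1) - n * thinR (Real.exp (-t)) x n) t := by
  simp only [thin_eq_sum hM]
  rw [Finset.mul_sum, Finset.mul_sum, ← Finset.sum_sub_distrib]
  apply HasDerivAt.fun_sum
  intro k _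
  have e : HasDerivAt (fun t => Real.exp (-t)) (-Real.exp (-t)) t := by
    simpa using (hasDerivAt_neg t).exp
  have e1 := (((e.pow n).const_mul (Nat.choose k n : ℝ)).mul ((e.const_sub 1).pow (k - n))).mul_const (x k)
  refine HasDerivAt.congr_deriv (f' := _) e1 ?_
  have hc : (Nat.choose k (n + 1) : ℝ) * (n + 1) = Nat.choose k n * ((k - n : ℕ) : ℝ) := by
    exact_mod_cast Nat.choose_succ_right_eq k n
  have hn : (n : ℝ) * Real.exp (-t) ^ (n - 1) * Real.exp (-t) = n * Real.exp (-t) ^ n := by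
    rcases n with _ | n
    · simp
    · simp [pow_succ]; ring
  rw [show k - (n + 1) = k - n - 1 by omega]
  simp only [Pi.pow_apply]
  set l := Real.exp (-t)
  linear_combination (-(l ^ (n + 1) * (1 - l) ^ (k - n - 1) * x k)) * hc
    - (Nat.choose k n : ℝ) * (1 - l) ^ (k - n) * x k * hn

theorem mu_eq {z a : ℝ} (hz0 : 0 < z) (hz1 : z < 1) (ha0 : 0 < a) :
    -mu z a * (-Real.log (z ^ (1 / a))) =
      a * (z ^ (1 / a)) ^ (a - 1) - 1 + (1 - a) * (z ^ (1 / a)) ^ a := by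
  have hlog : Real.log z < 0 := Real.log_neg hz0 hz1
  rw [← Real.rpow_mul hz0.le, ← Real.rpow_mul hz0.le, Real.log_rpow hz0, mu,
    show 1 / a * (a - 1) = (a - 1) / a by ring, show 1 / a * a = 1 by field_simp, Real.rpow_one]
  have := hlog.ne
  field_simp

theorem geom_deriv {z a : ℝ → ℝ} {t a' : ℝ} (hz0 : 0 < z t) (hz1 : z t < 1) (ha0 : 0 < a t)
    (hz : HasDerivAt z (-(z t * (1 - z t))) t) (ha : HasDerivAt a a' t) :
    HasDerivAt (fun t => Real.log (1 - z t) - a t * Real.log (1 - z t ^ (1 / a t)))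
      (((z t ^ (1 / a t)) ^ (a t) - z t ^ (1 / a t)
        + a' * Real.binEntropy (z t ^ (1 / a t))) / (1 - z t ^ (1 / a t))) t := by
  have hw0 : 0 < z t ^ (1 / a t) := Real.rpow_pos_of_pos hz0 _
  have hw1 : z t ^ (1 / a t) < 1 := Real.rpow_lt_one hz0.le hz1 (by positivity)
  have hinv : HasDerivAt (fun t => 1 / a t) (-a' / (a t) ^ 2) t := by
    simpa [one_div] using! ha.inv ha0.ne'
  have h1 := (hz.const_sub 1).log (by linarith : 1 - z t ≠ 0)
  have h2 := ((hz.rpow hinv hz0).const_sub 1).log (by linarith : 1 - z t ^ (1 / a t) ≠ 0)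
  have h3 := h1.sub (ha.mul h2)
  refine HasDerivAt.congr_deriv (f' := _) h3 ?_
  have e1 : (z t ^ (1 / a t)) ^ (a t) = z t := by
    rw [← Real.rpow_mul hz0.le, show 1 / a t * a t = 1 by field_simp, Real.rpow_one]
  have e2 : z t ^ (1 / a t - 1) = z t ^ (1 / a t) / z t := by
    rw [Real.rpow_sub hz0, Real.rpow_one]
  have e3 : Real.log (z t ^ (1 / a t)) = Real.log (z t) / a t := by
    rw [Real.log_rpow hz0]; ring
  rw [e1, e2, Real.binEntropy, Real.log_inv, Real.log_inv, e3]
  set w := z t ^ (1 / a t)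
  have hw2 : 1 - w ≠ 0 := by linarith
  have hz2 : 1 - z t ≠ 0 := by linarith
  have := hz0.ne'
  have := ha0.ne'
  field_simp
  ring

theorem geom_norm_s10 {z a : ℝ} (hz0 : 0 < z) (hz1 : z < 1) (ha0 : 0 < a) :
    lpNormR (1 / a) (geomR z) = Real.exp (Real.log (1 - z) - a * Real.log (1 - z ^ (1 / a))) := by
  have hw0 : 0 < z ^ (1 / a) := Real.rpow_pos_of_pos hz0 _
  have hw1 : z ^ (1 / a) < 1 := Real.rpow_lt_one hz0.le hz1 (by positivity)
  have h1 : 0 < 1 - z := by linarith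
  have h2 : 0 < 1 - z ^ (1 / a) := by linarith
  have hterm : ∀ n : ℕ, |geomR z n| ^ (1 / a) = (1 - z) ^ (1 / a) * (z ^ (1 / a)) ^ n := by
    intro n
    have : 0 < z ^ n := pow_pos hz0 n
    rw [geomR, abs_of_pos (by positivity), Real.mul_rpow h1.le this.le]
    congr 1
    rw [← Real.rpow_natCast, ← Real.rpow_natCast, ← Real.rpow_mul hz0.le, ← Real.rpow_mul hz0.le,
      mul_comm]
  rw [lpNormR]
  simp_rw [hterm]
  rw [tsum_mul_left, tsum_geometric_of_lt_one hw0.le hw1, one_div_one_div,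
    Real.mul_rpow (by positivity) (by positivity), ← Real.rpow_mul h1.le,
    show 1 / a * a = 1 by field_simp, Real.rpow_one, Real.exp_sub, Real.exp_log h1,
    Real.inv_rpow h2.le, mul_comm a, ← Real.rpow_def_of_pos h2]
  rfl

theorem fin_norm {a : ℝ} (ha0 : 0 < a) {M : ℕ} {y : ℕ → ℝ} (hM : ∀ n, M ≤ n → y n = 0)
    (hp : ∀ n, 0 ≤ y n) (hS : 0 < ∑ n ∈ Finset.range M, y n ^ (1 / a)) :
    lpNormR (1 / a) y = Real.exp (a * Real.log (∑ n ∈ Finset.range M, y n ^ (1 / a))) := by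
  rw [lpNormR, one_div_one_div, mul_comm a, ← Real.rpow_def_of_pos hS]
  congr 1
  simp_rw [abs_of_nonneg (hp _)]
  apply tsum_eq_sum
  intro k hk
  rw [hM k (by simpa using hk), Real.zero_rpow (by positivity)]

theorem norm_deriv {a : ℝ → ℝ} {X : ℕ → ℝ → ℝ} {M : ℕ} {t w m C : ℝ} (hM1 : 0 < M)
    (ha0 : 0 < a t) (ha1 : a t < 1) (ha : HasDerivAt a (-m) t)
    (hX0 : ∀ n, M ≤ n → X n t = 0) (hXp : ∀ n, n < M → 0 < X n t)
    (hX : ∀ n, HasDerivAt (X n) ((n + 1) * X (n + 1) t - n * X n t) t)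
    (hw0 : 0 < w) (hw1 : w < 1)
    (hm : m * (-Real.log w) = a t * w ^ (a t - 1) - 1 + (1 - a t) * w ^ a t)
    (hC : C * (1 - w) = w ^ a t - w - m * Real.binEntropy w) :
    ∃ D, D ≤ C ∧ HasDerivAt (fun t => a t * Real.log (∑ n ∈ Finset.range M, X n t ^ (1 / a t)))
      D t := by
  have hinv : HasDerivAt (fun t => 1 / a t) (m / (a t) ^ 2) t := by
    simpa [one_div] using! ha.inv ha0.ne'
  have hXn : ∀ n, 0 ≤ X n t := fun n => by
    rcases lt_or_ge n M with h | h
    · exact (hXp n h).le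
    · rw [hX0 n h]
  have hS : 0 < ∑ n ∈ Finset.range M, X n t ^ (1 / a t) := by
    apply Finset.sum_pos
    · intro n hn
      exact Real.rpow_pos_of_pos (hXp n (by simpa using hn)) _
    · simpa using hM1.ne'
  have hSd : HasDerivAt (fun t => ∑ n ∈ Finset.range M, X n t ^ (1 / a t)) _ t :=
    HasDerivAt.fun_sum (u := Finset.range M) (fun n hn =>
      (hX n).rpow hinv (hXp n (by simpa using hn)))
  have hd := ha.mul (hSd.log hS.ne')
  refine ⟨_, ?_, hd⟩
  have hst := static_ineq ha0 ha1 hw0 hw1 hm hC M (fun n => X n t ^ (1 / a t))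
    (fun n => Real.rpow_nonneg (hXn n) _)
    (fun n hn => by rw [hX0 n hn, Real.zero_rpow (by positivity)])
  have hXa : ∀ n, (X n t ^ (1 / a t)) ^ a t = X n t := fun n => by
    rw [← Real.rpow_mul (hXn n), show 1 / a t * a t = 1 by field_simp, Real.rpow_one]
  simp only [hXa] at hst
  set S := ∑ n ∈ Finset.range M, X n t ^ (1 / a t) with hSdef
  have hsum : a t * (∑ n ∈ Finset.range M,
      (((n + 1) * X (n + 1) t - n * X n t) * (1 / a t) * X n t ^ (1 / a t - 1) +
        m / (a t) ^ 2 * X n t ^ (1 / a t) * Real.log (X n t))) =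
      ∑ n ∈ Finset.range M, ((n + 1) * ((X n t ^ (1 / a t)) ^ (1 - a t) * X (n + 1) t)
        - n * X n t ^ (1 / a t)) +
      m * ∑ n ∈ Finset.range M, X n t ^ (1 / a t) * Real.log (X n t ^ (1 / a t)) := by
    rw [Finset.mul_sum, Finset.mul_sum, ← Finset.sum_add_distrib]
    apply Finset.sum_congr rfl
    intro n hn
    have hp := hXp n (by simpa using hn)
    rw [← Real.rpow_mul hp.le, show 1 / a t * (1 - a t) = 1 / a t - 1 by field_simp,
      Real.rpow_sub hp, Real.rpow_one, Real.log_rpow hp]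
    have := hp.ne'
    field_simp
  have hfin : -m * Real.log S * S + a t * (∑ n ∈ Finset.range M,
      (((n + 1) * X (n + 1) t - n * X n t) * (1 / a t) * X n t ^ (1 / a t - 1) +
        m / (a t) ^ 2 * X n t ^ (1 / a t) * Real.log (X n t))) ≤ C * S := by
    rw [hsum]; linarith
  rw [← mul_div_assoc, ← le_sub_iff_add_le', div_le_iff₀ hS]
  linarith

theorem z_facts {z₀ : ℝ} (h0 : 0 < z₀) (h1 : z₀ < 1) {z : ℝ → ℝ}
    (hz : ∀ t, z t = Real.exp (-t) * z₀ / (1 - (1 - Real.exp (-t)) * z₀)) (t : ℝ) :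
    0 < z t ∧ z t < 1 ∧ HasDerivAt z (-(z t * (1 - z t))) t := by
  have hl := Real.exp_pos (-t)
  have hden : 0 < 1 - (1 - Real.exp (-t)) * z₀ := by nlinarith
  refine ⟨by rw [hz]; positivity, ?_, ?_⟩
  · rw [hz, div_lt_one hden]; linarith
  · have e : HasDerivAt (fun t => Real.exp (-t)) (-Real.exp (-t)) t := by
      simpa using (hasDerivAt_neg t).exp
    have := (e.mul_const z₀).div (((e.const_sub 1).mul_const z₀).const_sub 1) hden.ne'
    rw [funext hz]
    refine HasDerivAt.congr_deriv (f' := _) this ?_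
    have hd := hden.ne'
    simp only
    generalize 1 - (1 - Real.exp (-t)) * z₀ = d at hd
    field_simp
    ring

theorem integrated_logSobolev (T z₀ : ℝ) (hT : 0 < T) (hz₀ : z₀ ∈ Set.Ioo (0 : ℝ) 1)
    (z : ℝ → ℝ)
    (hz : ∀ t, z t = Real.exp (-t) * z₀ / (1 - (1 - Real.exp (-t)) * z₀))
    (a : ℝ → ℝ) (ha : ∀ t ∈ Set.Icc (0 : ℝ) T, a t ∈ Set.Ioo (0 : ℝ) 1)
    (hderiv : ∀ t ∈ Set.Icc (0 : ℝ) T, HasDerivAt a (mu (z t) (a t)) t)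
    (x : ℕ → ℝ) (hx0 : x ≠ 0) (hfin : ∃ N, ∀ n ≥ N, x n = 0)
    (hnn : ∀ n, 0 ≤ x n) (hdec : ∀ n, x (n + 1) ≤ x n) :
    lpNormR (1 / a T) (thinR (Real.exp (-T)) x) * lpNormR (1 / a 0) (geomR z₀) ≤
      lpNormR (1 / a T) (geomR (z T)) * lpNormR (1 / a 0) x := by
  classical
  set M := Nat.find hfin with hMdef
  have hM : ∀ n, M ≤ n → x n = 0 := fun n hn => Nat.find_spec hfin n hn
  have hanti : Antitone x := antitone_nat_of_succ_le hdec
  have hp : ∀ n, n < M → 0 < x n := by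
    intro n hn
    have := Nat.find_min hfin hn
    push Not at this
    obtain ⟨k, hk, hk0⟩ := this
    exact ((hnn k).lt_of_ne' hk0).trans_le (hanti hk)
  have hM1 : 0 < M := by
    rcases Nat.eq_zero_or_pos M with h | h
    · exact absurd (funext fun n => hM n (by omega)) hx0
    · exact h
  set X : ℕ → ℝ → ℝ := fun n t => thinR (Real.exp (-t)) x n with hX
  have hX0 : ∀ t n, M ≤ n → X n t = 0 := fun t n hn => thin_zero hM _ n hn
  have hXp : ∀ t, 0 ≤ t → ∀ n, n < M → 0 < X n t := fun t ht n hn =>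
    thin_pos hM hp (Real.exp_pos _) (Real.exp_le_one_iff.2 (by linarith)) n hn
  set F : ℝ → ℝ := fun t => a t * Real.log (∑ n ∈ Finset.range M, X n t ^ (1 / a t)) with hF
  set G : ℝ → ℝ := fun t => Real.log (1 - z t) - a t * Real.log (1 - z t ^ (1 / a t)) with hG
  have hder : ∀ t ∈ Set.Icc (0 : ℝ) T, ∃ D, D ≤ 0 ∧ HasDerivAt (fun t => F t - G t) D t := by
    intro t ht
    obtain ⟨hz0, hz1, hzd⟩ := z_facts hz₀.1 hz₀.2 hz t
    obtain ⟨ha0, ha1⟩ := ha t ht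
    have hw0 : 0 < z t ^ (1 / a t) := Real.rpow_pos_of_pos hz0 _
    have hw1 : z t ^ (1 / a t) < 1 := Real.rpow_lt_one hz0.le hz1 (by positivity)
    have had := hderiv t ht
    have hg := geom_deriv hz0 hz1 ha0 hzd had
    have hw2 : 1 - z t ^ (1 / a t) ≠ 0 := by linarith
    obtain ⟨D, hD, hFd⟩ := norm_deriv (X := X) (m := -mu (z t) (a t)) hM1 ha0 ha1
      (by simpa using had) (hX0 t) (hXp t ht.1) (fun n => thin_deriv hM n t) hw0 hw1
      (mu_eq hz0 hz1 ha0) (C := ((z t ^ (1 / a t)) ^ (a t) - z t ^ (1 / a t)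
        + mu (z t) (a t) * Real.binEntropy (z t ^ (1 / a t))) / (1 - z t ^ (1 / a t)))
      (by rw [div_mul_cancel₀ _ hw2]; ring)
    exact ⟨_, sub_nonpos.2 hD, hFd.sub hg⟩
  have hmono : AntitoneOn (fun t => F t - G t) (Set.Icc 0 T) := by
    apply antitoneOn_of_deriv_nonpos (convex_Icc 0 T)
    · intro t ht
      obtain ⟨D, _, hD⟩ := hder t ht
      exact hD.continuousAt.continuousWithinAt
    · intro t ht
      obtain ⟨D, _, hD⟩ := hder t (interior_subset ht)
      exact hD.differentiableAt.differentiableWithinAt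
    · intro t ht
      obtain ⟨D, hD0, hD⟩ := hder t (interior_subset ht)
      rw [hD.deriv]; exact hD0
  have hle := hmono ⟨le_rfl, hT.le⟩ ⟨hT.le, le_rfl⟩ hT.le
  simp only at hle
  have hnorm : ∀ t ∈ Set.Icc (0 : ℝ) T,
      lpNormR (1 / a t) (thinR (Real.exp (-t)) x) = Real.exp (F t) := by
    intro t ht
    apply fin_norm (ha t ht).1 (y := fun n => X n t) (hX0 t)
    · intro n
      rcases lt_or_ge n M with h | h
      · exact (hXp t ht.1 n h).le
      · rw [hX0 t n h]
    · apply Finset.sum_pos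
      · intro n hn
        exact Real.rpow_pos_of_pos (hXp t ht.1 n (by simpa using hn)) _
      · simpa using hM1.ne'
  have hid : thinR (Real.exp (-0)) x = x := by
    funext n
    rw [neg_zero, Real.exp_zero, thinR, tsum_eq_single n]
    · simp
    · intro k hk
      rcases lt_or_gt_of_ne hk with h | h
      · simp [Nat.choose_eq_zero_of_lt h]
      · have : k - n ≠ 0 := by omega
        simp [this]
  have hz00 : z 0 = z₀ := by rw [hz]; simp
  have h0mem : (0 : ℝ) ∈ Set.Icc 0 T := ⟨le_rfl, hT.le⟩
  have hTmem : T ∈ Set.Icc 0 T := ⟨hT.le, le_rfl⟩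
  have n0 := hnorm 0 h0mem
  rw [hid] at n0
  have zT := z_facts hz₀.1 hz₀.2 hz T
  have gT := geom_norm_s10 zT.1 zT.2.1 (ha T hTmem).1
  have g0 := geom_norm_s10 (z := z 0) (by rw [hz00]; exact hz₀.1) (by rw [hz00]; exact hz₀.2)
    (ha 0 h0mem).1
  rw [hnorm T hTmem, n0, gT, ← hz00, g0, ← Real.exp_add, ← Real.exp_add, Real.exp_le_exp]
  simp only [hG] at hle
  linarith
end
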